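/- There exists a constant C > 0 such that for every n ≥ 2 and all s, t ∈ [a_{n+1}, a_n], the total variation distance between the corresponding Gibbs measures satisfies d_TV(ν_s, ν_t) ≤ C / (n log n). -/

import Mathlib

open MeasureTheory Filter

/-- Total variation distance between two measures. -/
noncomputable def dTV {E : Type*} [MeasurableSpace E] (μ ν : Measure E) : ℝ :=
  2 * ⨆ B : {B : Set E // MeasurableSet B}, |(μ B).toReal - (ν B).toReal|

/-- The Gibbs measure `ν_a(dx) ∝ e^{−2(V(x)−V*)/a²} dx` on `ℝ^d`. -/
noncomputable def gibbs {d : ℕ} (V : EuclideanSpace ℝ (Fin d) → ℝ) (Vstar a : ℝ) :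
    Measure (EuclideanSpace ℝ (Fin d)) :=
  (∫⁻ x, ENNReal.ofReal (Real.exp (-2 * (V x - Vstar) / a ^ 2)))⁻¹ •
    volume.withDensity fun x => ENNReal.ofReal (Real.exp (-2 * (V x - Vstar) / a ^ 2))

lemma dTV_comm {E : Type*} [MeasurableSpace E] (μ ν : Measure E) : dTV μ ν = dTV ν μ := by
  simp only [dTV, abs_sub_comm]

/-- If `ν ≤ (1 + ε) μ` for probability measures `μ`, `ν`, then `dTV μ ν ≤ 2 ε`. -/
lemma dTV_le_of_le_mul {E : Type*} [MeasurableSpace E] {μ ν : Measure E}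
    [IsProbabilityMeasure μ] [IsProbabilityMeasure ν] {ε : ℝ} (hε : 0 ≤ ε)
    (h : ∀ B, MeasurableSet B → ν.real B ≤ (1 + ε) * μ.real B) : dTV μ ν ≤ 2 * ε := by
  have key : ∀ B, MeasurableSet B → ν.real B - μ.real B ≤ ε := fun B hB => by
    have h1 : ε * μ.real B ≤ ε * 1 := by gcongr; exact measureReal_le_one
    linarith [h B hB]
  unfold dTV
  gcongr
  refine Real.iSup_le (fun B => ?_) hε
  change |μ.real B - ν.real B| ≤ ε
  have h1 := key B B.2
  have h2 := key _ B.2.compl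
  rw [probReal_compl_eq_one_sub B.2, probReal_compl_eq_one_sub B.2] at h2
  rw [abs_le]
  constructor <;> linarith

/-- A `C²` function is squeezed between two quadratics near a nondegenerate minimum. -/
lemma exists_quadratic_bounds {E : Type*} [NormedAddCommGroup E] [NormedSpace ℝ E]
    [FiniteDimensional ℝ E] {f : E → ℝ} (hf : ContDiff ℝ 2 f) {x : E} (hx : IsLocalMin f x)
    (hpos : ∀ v : E, v ≠ 0 → 0 < iteratedFDeriv ℝ 2 f x ![v, v]) :
    ∃ k > 0, ∃ K > 0, ∃ r > 0, ∀ y : E, ‖y‖ < r →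
      k * ‖y‖ ^ 2 ≤ f (x + y) - f x ∧ f (x + y) - f x ≤ K * ‖y‖ ^ 2 := by
  set g := fderiv ℝ f with hg
  have hgx : g x = 0 := hx.fderiv_eq_zero
  have hgd : ContDiff ℝ 1 g := hf.fderiv_right (by norm_num)
  set H := fderiv ℝ g x with hH
  have hHd : HasFDerivAt g H x := (hgd.differentiable (by norm_num) x).hasFDerivAt
  obtain ⟨k, hk, hkH⟩ : ∃ k : ℝ, 0 < k ∧ ∀ v ∈ Metric.sphere (0 : E) 1, k ≤ H v v := by
    refine (isCompact_sphere (0 : E) 1).exists_forall_le' (by fun_prop) fun v hv => ?_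
    have := hpos v (by rintro rfl; simp at hv)
    simpa [iteratedFDeriv_two_apply] using this
  have hlow : ∀ v, k * ‖v‖ ^ 2 ≤ H v v := fun v => by
    rcases eq_or_ne v 0 with rfl | hv
    · simp
    have hv' : 0 < ‖v‖ := norm_pos_iff.2 hv
    have := hkH (‖v‖⁻¹ • v) (by simp [norm_smul, hv'.ne'])
    simp only [map_smul, smul_apply, smul_eq_mul] at this
    calc k * ‖v‖ ^ 2 ≤ (‖v‖⁻¹ * (‖v‖⁻¹ * H v v)) * ‖v‖ ^ 2 := by gcongr
      _ = H v v := by field_simp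
  have hup : ∀ v, H v v ≤ ‖H‖ * ‖v‖ ^ 2 := fun v => by
    have := (le_abs_self _).trans (H.le_opNorm₂ v v)
    linarith
  have hlit := (hasFDerivAt_iff_isLittleO_nhds_zero.1 hHd).def (half_pos hk)
  obtain ⟨r, hr, hball⟩ := Metric.eventually_nhds_iff_ball.1 hlit
  have hbd : ∀ c ∈ Set.Ioo (0 : ℝ) 1, ∀ y, ‖y‖ < r →
      |g (x + c • y) y - c * H y y| ≤ k / 2 * c * ‖y‖ ^ 2 := fun c hc y hy => by
    have h1 := hball (c • y) (by
      rw [mem_ball_zero_iff, norm_smul, Real.norm_of_nonneg hc.1.le]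
      nlinarith [hc.2, norm_nonneg y])
    rw [hgx, sub_zero, norm_smul, Real.norm_of_nonneg hc.1.le] at h1
    have h2 := (ContinuousLinearMap.le_opNorm (g (x + c • y) - H (c • y)) y).trans
      (mul_le_mul_of_nonneg_right h1 (norm_nonneg y))
    simp only [sub_apply, map_smul, smul_apply,
      smul_eq_mul, Real.norm_eq_abs] at h2
    linarith
  refine ⟨k / 4, by positivity, ‖H‖ / 2 + k / 4, by positivity, r, hr, fun y hy => ?_⟩
  have hφ : ∀ t : ℝ, HasDerivAt (fun t : ℝ => f (x + t • y)) (g (x + t • y) y) t := fun t => by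
    have h1 : HasDerivAt (fun t : ℝ => x + t • y) y t := by
      simpa using ((hasDerivAt_id t).smul_const y).const_add x
    exact ((hf.differentiable (by norm_num) _).hasFDerivAt).comp_hasDerivAt t h1
  obtain ⟨c, hc, hceq⟩ := exists_ratio_hasDerivAt_eq_ratio_slope
    (fun t : ℝ => f (x + t • y)) (fun t => g (x + t • y) y) zero_lt_one
    (fun t _ => (hφ t).continuousAt.continuousWithinAt) (fun t _ => hφ t)
    (fun t : ℝ => t ^ 2) (fun t => 2 * t) (by fun_prop)
    (fun t _ => by simpa using hasDerivAt_pow 2 t)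
  simp only [one_smul, zero_smul, add_zero] at hceq
  have h1 := abs_le.1 (hbd c hc y hy)
  have h2 := mul_le_mul_of_nonneg_left (hlow y) hc.1.le
  have h3 := mul_le_mul_of_nonneg_left (hup y) hc.1.le
  have hc2 : 0 < 2 * c := by linarith [hc.1]
  constructor <;> refine le_of_mul_le_mul_right ?_ hc2 <;> nlinarith [h1.1, h1.2]

/-- Near a nondegenerate minimum, a homothety towards the minimizer shrinks `f - f x` by an
arbitrary factor. -/
lemma exists_homothety_le {E : Type*} [NormedAddCommGroup E] [NormedSpace ℝ E]
    [FiniteDimensional ℝ E] {f : E → ℝ} (hf : ContDiff ℝ 2 f) {x : E} (hx : IsLocalMin f x)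
    (hpos : ∀ v : E, v ≠ 0 → 0 < iteratedFDeriv ℝ 2 f x ![v, v]) {θ : ℝ} (hθ : 0 < θ) :
    ∃ ρ > (0 : ℝ), ∃ r > 0, ∀ y : E, ‖y‖ < r → f (x + ρ • y) - f x ≤ θ * (f (x + y) - f x) := by
  obtain ⟨k, hk, K, hK, r, hr, h⟩ := exists_quadratic_bounds hf hx hpos
  have hq : 0 < √(θ * k / K) := by positivity
  refine ⟨min 1 √(θ * k / K), lt_min one_pos hq, r, hr, fun y hy => ?_⟩
  set ρ := min 1 √(θ * k / K)
  have hρ : 0 < ρ := lt_min one_pos hq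
  have hρ1 : ρ ≤ 1 := min_le_left _ _
  have hρ2 : ρ ^ 2 ≤ θ * k / K := by
    rw [← Real.sq_sqrt (by positivity : 0 ≤ θ * k / K)]
    gcongr
    exact min_le_right _ _
  have hn : ‖ρ • y‖ = ρ * ‖y‖ := by rw [norm_smul, Real.norm_of_nonneg hρ.le]
  calc f (x + ρ • y) - f x ≤ K * ‖ρ • y‖ ^ 2 :=
        (h _ (by rw [hn]; nlinarith [norm_nonneg y])).2
    _ = K * ρ ^ 2 * ‖y‖ ^ 2 := by rw [hn]; ring
    _ ≤ K * (θ * k / K) * ‖y‖ ^ 2 := by gcongr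
    _ = θ * (k * ‖y‖ ^ 2) := by field_simp
    _ ≤ θ * (f (x + y) - f x) := by gcongr; exact (h y hy).1

open scoped ENNReal

/-- The partition function `u ↦ ∫ e^{-u W}`. -/
noncomputable def partitionFn {E : Type*} [MeasurableSpace E] (μ : Measure E) (W : E → ℝ)
    (u : ℝ) : ℝ≥0∞ :=
  ∫⁻ x, ENNReal.ofReal (Real.exp (-(u * W x))) ∂μ

lemma lintegral_comp_homothety {E : Type*} [NormedAddCommGroup E] [NormedSpace ℝ E]
    [FiniteDimensional ℝ E] [MeasurableSpace E] [BorelSpace E] (μ : Measure E)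
    [μ.IsAddHaarMeasure] {F : E → ℝ≥0∞} (hF : Measurable F) (x : E) {ρ : ℝ} (hρ : ρ ≠ 0) :
    ∫⁻ z, F (x + ρ • (z - x)) ∂μ =
      ENNReal.ofReal |(ρ ^ Module.finrank ℝ E)⁻¹| * ∫⁻ z, F z ∂μ := by
  rw [lintegral_sub_right_eq_self (fun z => F (x + ρ • z)) x,
    ← lintegral_map (μ := μ) (f := fun z => F (x + z)) (g := fun z => ρ • z) (by fun_prop)
      (by fun_prop), Measure.map_addHaar_smul μ hρ, lintegral_smul_measure,
    lintegral_add_left_eq_self, smul_eq_mul]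

lemma exists_pos_le_off_balls {E : Type*} [NormedAddCommGroup E] {W : E → ℝ}
    (hW : Continuous W) (hcoer : Tendsto W (cocompact E) atTop) {S : Set E}
    (hpos : ∀ x ∉ S, 0 < W x) {r : E → ℝ} (hr : ∀ x ∈ S, 0 < r x) :
    ∃ m > 0, ∀ z, (∀ x ∈ S, r x ≤ ‖z - x‖) → m ≤ W z := by
  obtain ⟨K, hK, hKW⟩ := mem_cocompact.1 (hcoer.eventually_ge_atTop 1)
  set U : Set E := ⋃ x ∈ S, Metric.ball x (r x)
  have hU : IsOpen U := isOpen_biUnion fun _ _ => Metric.isOpen_ball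
  obtain ⟨m, hm, hmK⟩ := (hK.diff hU).exists_forall_le' hW.continuousOn (a := 0) fun z hz =>
    hpos z fun hzS => hz.2 <| Set.mem_biUnion hzS (Metric.mem_ball_self (hr z hzS))
  refine ⟨min m 1, lt_min hm one_pos, fun z hz => ?_⟩
  by_cases hzK : z ∈ K
  · refine (min_le_left _ _).trans (hmK z ⟨hzK, fun hzU => ?_⟩)
    obtain ⟨x, hx, hzx⟩ := Set.mem_iUnion₂.1 hzU
    exact (hz x hx).not_gt (mem_ball_iff_norm.1 hzx)
  · exact (min_le_right _ _).trans (hKW hzK)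

/-- A doubling property of the partition function of a potential with finitely many
zeros, around each of which suitable homotheties shrink the potential. -/
lemma partitionFn_doubling {E : Type*} [NormedAddCommGroup E] [NormedSpace ℝ E]
    [FiniteDimensional ℝ E] [MeasurableSpace E] [BorelSpace E] (μ : Measure E)
    [μ.IsAddHaarMeasure] {W : E → ℝ} (hW : Continuous W) (hW0 : ∀ x, 0 ≤ W x)
    (hcoer : Tendsto W (cocompact E) atTop) {S : Finset E} (hS : S.Nonempty)
    (hWS : ∀ x, W x = 0 ↔ x ∈ S)
    (hshrink : ∀ x ∈ S, ∀ θ > 0, ∃ ρ > (0 : ℝ), ∃ r > 0, ∀ y : E, ‖y‖ < r →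
      W (x + ρ • y) ≤ θ * W (x + y))
    {u₀ : ℝ} (hu₀ : 0 < u₀) (hfin : partitionFn μ W u₀ ≠ ∞) {R : ℝ} (hR : 0 < R) :
    ∃ D : ℝ≥0∞, D ≠ ∞ ∧ ∀ w v, u₀ ≤ w → v ≤ R * w →
      partitionFn μ W w ≤ D * partitionFn μ W v := by
  have hshrink' : ∀ x : E, ∃ ρ r : ℝ, x ∈ S → 0 < ρ ∧ 0 < r ∧ ∀ y : E, ‖y‖ < r →
      W (x + ρ • y) ≤ R⁻¹ * W (x + y) := fun x => by
    by_cases hx : x ∈ S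
    · obtain ⟨ρ, hρ, r, hr, h⟩ := hshrink x hx R⁻¹ (by positivity)
      exact ⟨ρ, r, fun _ => ⟨hρ, hr, h⟩⟩
    · exact ⟨0, 0, fun h => absurd h hx⟩
  choose ρ r hρr using hshrink'
  obtain ⟨m, hm, hmW⟩ := exists_pos_le_off_balls hW hcoer (S := (S : Set E))
    (fun x hx => (hW0 x).lt_of_ne fun h => hx ((hWS x).1 h.symm)) (r := r)
    (fun x hx => (hρr x hx).2.1)
  set M := μ {z | W z < m / R}
  have hM0 : M ≠ 0 := by
    obtain ⟨x, hx⟩ := hS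
    refine ((isOpen_lt hW continuous_const).measure_pos μ ⟨x, ?_⟩).ne'
    simp only [Set.mem_ofPred_eq, (hWS x).2 hx]
    positivity
  have hmeas : ∀ u : ℝ, Measurable fun z => ENNReal.ofReal (Real.exp (-(u * W z))) :=
    fun u => by fun_prop
  have hlow : ∀ v, ENNReal.ofReal (Real.exp (-(max v 0 * (m / R)))) * M ≤ partitionFn μ W v := by
    intro v
    refine le_trans ?_ (mul_meas_ge_le_lintegral (hmeas v)
      (ENNReal.ofReal (Real.exp (-(max v 0 * (m / R))))))
    refine mul_le_mul_right (measure_mono fun z hz => ?_) _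
    refine ENNReal.ofReal_le_ofReal (Real.exp_le_exp.2 (neg_le_neg ?_))
    exact mul_le_mul (le_max_left _ _) (le_of_lt hz) (hW0 z) (le_max_right _ _)
  have hMfin : M ≠ ∞ := fun h => by
    have := hlow u₀
    rw [h, ENNReal.mul_top (by simp [Real.exp_pos])] at this
    exact hfin (top_le_iff.1 this)
  refine ⟨(∑ x ∈ S, ENNReal.ofReal |(ρ x ^ Module.finrank ℝ E)⁻¹|) +
    ENNReal.ofReal (Real.exp (u₀ * m)) * partitionFn μ W u₀ / M, ?_, fun w v hw hv => ?_⟩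
  · refine ENNReal.add_ne_top.2 ⟨by simp, ENNReal.div_ne_top (ENNReal.mul_ne_top (by simp) hfin) hM0⟩
  have hw0 : 0 < w := hu₀.trans_le hw
  have hpt : ∀ z, ENNReal.ofReal (Real.exp (-(w * W z))) ≤
      (∑ x ∈ S, ENNReal.ofReal (Real.exp (-(v * W (x + ρ x • (z - x)))))) +
        ENNReal.ofReal (Real.exp (-((w - u₀) * m))) *
          ENNReal.ofReal (Real.exp (-(u₀ * W z))) := fun z => by
    by_cases hz : ∀ x ∈ S, r x ≤ ‖z - x‖
    · refine le_add_left ?_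
      rw [← ENNReal.ofReal_mul (Real.exp_pos _).le, ← Real.exp_add]
      refine ENNReal.ofReal_le_ofReal (Real.exp_le_exp.2 ?_)
      nlinarith [hmW z hz]
    · push Not at hz
      obtain ⟨x, hx, hzx⟩ := hz
      refine le_add_right (le_trans ?_ (Finset.single_le_sum
        (f := fun x => ENNReal.ofReal (Real.exp (-(v * W (x + ρ x • (z - x))))))
        (fun _ _ => zero_le) hx))
      refine ENNReal.ofReal_le_ofReal (Real.exp_le_exp.2 (neg_le_neg ?_))
      have h1 := (hρr x hx).2.2 (z - x) hzx
      rw [add_sub_cancel] at h1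
      calc v * W (x + ρ x • (z - x)) ≤ R * w * W (x + ρ x • (z - x)) := by
            gcongr; exact hW0 _
        _ ≤ R * w * (R⁻¹ * W z) := by gcongr
        _ = w * W z := by field_simp
  calc partitionFn μ W w ≤ ∫⁻ z, ((∑ x ∈ S, ENNReal.ofReal
        (Real.exp (-(v * W (x + ρ x • (z - x)))))) +
        ENNReal.ofReal (Real.exp (-((w - u₀) * m))) *
          ENNReal.ofReal (Real.exp (-(u₀ * W z)))) ∂μ := lintegral_mono hpt
    _ = (∑ x ∈ S, ENNReal.ofReal |(ρ x ^ Module.finrank ℝ E)⁻¹|) * partitionFn μ W v +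
        ENNReal.ofReal (Real.exp (-((w - u₀) * m))) * partitionFn μ W u₀ := by
      rw [lintegral_add_right _ (by fun_prop), lintegral_const_mul _ (hmeas _),
        lintegral_finsetSum _ (fun _ _ => by fun_prop), Finset.sum_mul]
      congr 1
      refine Finset.sum_congr rfl fun x hx => ?_
      exact lintegral_comp_homothety μ (hmeas v) x (hρr x hx).1.ne'
    _ ≤ _ := by
      rw [add_mul]
      refine add_le_add_right ?_ _
      have hexp : ENNReal.ofReal (Real.exp (-((w - u₀) * m))) ≤ ENNReal.ofReal
          (Real.exp (u₀ * m)) * ENNReal.ofReal (Real.exp (-(max v 0 * (m / R)))) := by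
        rw [← ENNReal.ofReal_mul (Real.exp_pos _).le, ← Real.exp_add]
        refine ENNReal.ofReal_le_ofReal (Real.exp_le_exp.2 ?_)
        have : max v 0 * (m / R) ≤ R * w * (m / R) := by
          gcongr
          exact max_le hv (by positivity)
        have h2 : R * w * (m / R) = w * m := by field_simp
        linarith
      calc _ ≤ ENNReal.ofReal (Real.exp (u₀ * m)) *
            ENNReal.ofReal (Real.exp (-(max v 0 * (m / R)))) * partitionFn μ W u₀ := by gcongr
        _ = ENNReal.ofReal (Real.exp (u₀ * m)) * partitionFn μ W u₀ / M *
            (ENNReal.ofReal (Real.exp (-(max v 0 * (m / R)))) * M) := by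
          rw [mul_comm _ M, ← mul_assoc, ENNReal.div_mul_cancel hM0 hMfin]
          ring
        _ ≤ _ := by gcongr; exact hlow v

/-- Under a doubling property, the logarithm of the partition function is Lipschitz in `log u`. -/
lemma partitionFn_le_mul {E : Type*} [MeasurableSpace E] {μ : Measure E} {W : E → ℝ}
    (hW : Measurable W) {u₀ δ R : ℝ} (hu₀ : 0 < u₀) (hδ : 0 < δ) {D : ℝ≥0∞}
    (hD : D ≠ ∞) (hdoub : ∀ w v, u₀ ≤ w → v ≤ R * (1 + δ) * w →
      partitionFn μ W w ≤ D * partitionFn μ W v)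
    {u v : ℝ} (hu : (1 + δ) * u₀ ≤ u) (huv : u ≤ v) (hv : v ≤ R * u) :
    partitionFn μ W u ≤
      ENNReal.ofReal (1 + (1 + δ) / δ * D.toReal * ((v - u) / u)) * partitionFn μ W v := by
  have hu0 : 0 < u := lt_of_lt_of_le (by positivity) hu
  set c := (v - u) / u * ((1 + δ) / δ) with hc
  have hc0 : 0 ≤ c := mul_nonneg (div_nonneg (by linarith) hu0.le) (by positivity)
  have hpt : ∀ z, Real.exp (-(u * W z)) ≤
      Real.exp (-(v * W z)) + c * Real.exp (-(u / (1 + δ) * W z)) := fun z => by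
    have h1 : 1 - (v - u) * W z ≤ Real.exp (-((v - u) * W z)) := by
      linarith [Real.add_one_le_exp (-((v - u) * W z))]
    have h2 : Real.exp (-(v * W z)) =
        Real.exp (-(u * W z)) * Real.exp (-((v - u) * W z)) := by
      rw [← Real.exp_add]; ring_nf
    have h3 : Real.exp (-(u / (1 + δ) * W z)) =
        Real.exp (-(u * W z)) * Real.exp (u * W z * (δ / (1 + δ))) := by
      rw [← Real.exp_add]; congr 1; field_simp; ring
    have h4 : u * W z * (δ / (1 + δ)) ≤ Real.exp (u * W z * (δ / (1 + δ))) := by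
      linarith [Real.add_one_le_exp (u * W z * (δ / (1 + δ)))]
    have h5 : (v - u) * W z ≤ c * Real.exp (u * W z * (δ / (1 + δ))) :=
      calc (v - u) * W z = c * (u * W z * (δ / (1 + δ))) := by rw [hc]; field_simp
        _ ≤ _ := by gcongr
    rw [h2, h3]
    nlinarith [Real.exp_pos (-(u * W z))]
  have hdb := hdoub (u / (1 + δ)) v (by rw [le_div_iff₀ (by positivity)]; linarith) (by
    rw [mul_assoc, mul_div_cancel₀ _ (by positivity : (1 + δ) ≠ 0)]; exact hv)
  calc partitionFn μ W u ≤ ∫⁻ z, (ENNReal.ofReal (Real.exp (-(v * W z))) +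
        ENNReal.ofReal c * ENNReal.ofReal (Real.exp (-(u / (1 + δ) * W z)))) ∂μ := by
        refine lintegral_mono fun z => ?_
        rw [← ENNReal.ofReal_mul hc0, ← ENNReal.ofReal_add (by positivity) (by positivity)]
        exact ENNReal.ofReal_le_ofReal (hpt z)
    _ = partitionFn μ W v + ENNReal.ofReal c * partitionFn μ W (u / (1 + δ)) := by
        rw [lintegral_add_right _ (by fun_prop), lintegral_const_mul _ (by fun_prop)]; rfl
    _ ≤ partitionFn μ W v + ENNReal.ofReal c * (D * partitionFn μ W v) := by gcongr
    _ = _ := by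
        rw [show 1 + (1 + δ) / δ * D.toReal * ((v - u) / u) = 1 + c * D.toReal by rw [hc]; ring,
          ENNReal.ofReal_add zero_le_one (by positivity), ENNReal.ofReal_mul hc0,
          ENNReal.ofReal_toReal hD, ENNReal.ofReal_one]
        ring

lemma log_schedule_increment_le {CT β : ℝ} (hCT : 0 < CT) (hβ : 0 < β) {x : ℝ} (hx : 1 < x) :
    (Real.log (CT * (x + 1) ^ (1 + β) + Real.exp 1) -
      Real.log (CT * x ^ (1 + β) + Real.exp 1)) / Real.log (CT * x ^ (1 + β) + Real.exp 1) ≤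
      (1 + |Real.log CT|) / (x * Real.log x) := by
  have hx0 : 0 < x := by linarith
  have hlx : 0 < Real.log x := Real.log_pos hx
  have hT : 0 < CT * x ^ (1 + β) := by positivity
  set L := Real.log (CT * x ^ (1 + β) + Real.exp 1) with hL
  have hL1 : 1 ≤ L := by
    rw [hL, Real.le_log_iff_exp_le (by positivity)]
    linarith
  have hL2 : Real.log CT + (1 + β) * Real.log x ≤ L := by
    rw [← Real.log_rpow hx0, ← Real.log_mul hCT.ne' (by positivity)]
    exact Real.log_le_log hT (by linarith [Real.exp_pos 1])
  have hL3 : (1 + β) * Real.log x ≤ (1 + |Real.log CT|) * L := by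
    nlinarith [neg_abs_le (Real.log CT), abs_nonneg (Real.log CT)]
  have hdiff : Real.log (CT * (x + 1) ^ (1 + β) + Real.exp 1) - L ≤ (1 + β) / x := by
    rw [hL, ← Real.log_div (by positivity) (by positivity)]
    have h1 : (CT * (x + 1) ^ (1 + β) + Real.exp 1) / (CT * x ^ (1 + β) + Real.exp 1) ≤
        ((x + 1) / x) ^ (1 + β) := by
      rw [div_le_iff₀ (by positivity)]
      have h2 : 1 ≤ ((x + 1) / x) ^ (1 + β) :=
        Real.one_le_rpow (by rw [le_div_iff₀ hx0]; linarith) (by linarith)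
      have h3 : ((x + 1) / x) ^ (1 + β) * x ^ (1 + β) = (x + 1) ^ (1 + β) := by
        rw [← Real.mul_rpow (by positivity) hx0.le, div_mul_cancel₀ _ hx0.ne']
      nlinarith [Real.exp_pos 1]
    calc _ ≤ Real.log (((x + 1) / x) ^ (1 + β)) := Real.log_le_log (by positivity) h1
      _ = (1 + β) * Real.log ((x + 1) / x) := Real.log_rpow (by positivity) _
      _ ≤ (1 + β) * ((x + 1) / x - 1) := by
        gcongr
        exact Real.log_le_sub_one_of_pos (by positivity)
      _ = (1 + β) / x := by field_simp; ring
  rw [div_le_div_iff₀ (by linarith) (by positivity)]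
  calc _ ≤ (1 + β) / x * (x * Real.log x) := by gcongr
    _ = (1 + β) * Real.log x := by field_simp
    _ ≤ _ := hL3

lemma lintegral_exp_ne_top {E : Type*} [NormedAddCommGroup E] [ProperSpace E]
    [MeasurableSpace E] [BorelSpace E] {μ : Measure E} [IsFiniteMeasureOnCompacts μ]
    {g : E → ℝ} (hg : Continuous g) (hint : Integrable (fun x => ‖x‖ ^ 2 * Real.exp (g x)) μ) :
    ∫⁻ x, ENNReal.ofReal (Real.exp (g x)) ∂μ ≠ ∞ := by
  have h1 : IntegrableOn (fun x => Real.exp (g x)) (Metric.closedBall 0 1) μ :=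
    (by fun_prop : Continuous fun x => Real.exp (g x)).continuousOn.integrableOn_compact
      (isCompact_closedBall _ _)
  have h2 : IntegrableOn (fun x => Real.exp (g x)) (Metric.closedBall 0 1)ᶜ μ := by
    refine hint.integrableOn.mono' (by fun_prop) ?_
    refine (ae_restrict_iff' Metric.isClosed_closedBall.measurableSet.compl).2
      (Eventually.of_forall fun x hx => ?_)
    have hx1 : 1 < ‖x‖ := by simpa using hx
    rw [Real.norm_of_nonneg (Real.exp_pos _).le]
    exact le_mul_of_one_le_left (Real.exp_pos _).le (one_le_pow₀ hx1.le)
  have h3 := h1.union h2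
  rw [Set.union_compl_self, integrableOn_univ] at h3
  exact h3.lintegral_lt_top.ne

section Gibbs

variable {d : ℕ} {V : EuclideanSpace ℝ (Fin d) → ℝ} {Vstar : ℝ}

lemma gibbs_apply (a : ℝ) {B : Set (EuclideanSpace ℝ (Fin d))}
    (hB : MeasurableSet B) :
    gibbs V Vstar a B = (partitionFn volume (fun x => V x - Vstar) (2 / a ^ 2))⁻¹ *
      ∫⁻ x in B, ENNReal.ofReal (Real.exp (-(2 / a ^ 2 * (V x - Vstar)))) := by
  have h : ∀ x, -2 * (V x - Vstar) / a ^ 2 = -(2 / a ^ 2 * (V x - Vstar)) := fun x => by ring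
  simp only [gibbs, h, partitionFn, Measure.smul_apply, smul_eq_mul, withDensity_apply _ hB]

lemma partitionFn_ne_zero {E : Type*} [MeasurableSpace E] {μ : Measure E} [NeZero μ] {W : E → ℝ}
    (hW : Measurable W) (u : ℝ) : partitionFn μ W u ≠ 0 := by
  rw [partitionFn, Ne, lintegral_eq_zero_iff (by fun_prop)]
  intro h
  have : ∀ᵐ x ∂μ, False := h.mono fun x hx => by
    simp [(Real.exp_pos _).not_ge] at hx
  simp [NeZero.ne μ] at this

lemma partitionFn_antitone {E : Type*} [MeasurableSpace E] {μ : Measure E} {W : E → ℝ}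
    (hW0 : ∀ x, 0 ≤ W x) : Antitone (partitionFn μ W) := fun u v huv => by
  refine lintegral_mono fun x => ENNReal.ofReal_le_ofReal (Real.exp_le_exp.2 (neg_le_neg ?_))
  exact mul_le_mul_of_nonneg_right huv (hW0 x)

lemma isProbabilityMeasure_gibbs (hV : Measurable V) {a : ℝ}
    (hfin : partitionFn volume (fun x => V x - Vstar) (2 / a ^ 2) ≠ ∞) :
    IsProbabilityMeasure (gibbs V Vstar a) := by
  refine ⟨?_⟩
  rw [gibbs_apply a .univ, setLIntegral_univ]
  exact ENNReal.inv_mul_cancel (partitionFn_ne_zero (by fun_prop) _) hfin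

/-- The total variation distance of two Gibbs measures is controlled by the ratio of their
partition functions. -/
lemma dTV_gibbs_le (hV : Measurable V) (hVstar : ∀ x, Vstar ≤ V x) {s t ε : ℝ} (hε : 0 ≤ ε)
    (hst : 2 / s ^ 2 ≤ 2 / t ^ 2)
    (hfin : partitionFn volume (fun x => V x - Vstar) (2 / s ^ 2) ≠ ∞)
    (hratio : partitionFn volume (fun x => V x - Vstar) (2 / s ^ 2) ≤
      ENNReal.ofReal (1 + ε) * partitionFn volume (fun x => V x - Vstar) (2 / t ^ 2)) :
    dTV (gibbs V Vstar s) (gibbs V Vstar t) ≤ 2 * ε := by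
  have hfin' : partitionFn volume (fun x => V x - Vstar) (2 / t ^ 2) ≠ ∞ :=
    ne_top_of_le_ne_top hfin (partitionFn_antitone (fun x => sub_nonneg.2 (hVstar x)) hst)
  have := isProbabilityMeasure_gibbs hV hfin
  have := isProbabilityMeasure_gibbs hV hfin'
  refine dTV_le_of_le_mul hε fun B hB => ?_
  have hle : gibbs V Vstar t B ≤ ENNReal.ofReal (1 + ε) * gibbs V Vstar s B := by
    rw [gibbs_apply _ hB, gibbs_apply _ hB, ← mul_assoc]
    gcongr ?_ * ?_
    · rw [← div_eq_mul_inv, ENNReal.le_div_iff_mul_le (.inl (partitionFn_ne_zero (by fun_prop) _))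
        (.inl hfin), mul_comm, ← div_eq_mul_inv]
      exact ENNReal.div_le_of_le_mul hratio
    · refine lintegral_mono fun x => ?_
      gcongr
      exact sub_nonneg.2 (hVstar x)
  have h2 := ENNReal.toReal_mono (by finiteness) hle
  rwa [ENNReal.toReal_mul, ENNReal.toReal_ofReal (by positivity)] at h2

end Gibbs

/-- With `T_n = C_T n^{1+β}` and `a_n = A/√(log(T_n+e))`, there is a constant `C > 0` such
that `d_TV(ν_s, ν_t) ≤ C/(n log n)` for all `n ≥ 2` and all `s, t ∈ [a_{n+1}, a_n]`. -/
theorem dTV_gibbs_interval (d : ℕ) (hd : 0 < d) (A CT β : ℝ) (hA : 0 < A) (hCT : 0 < CT)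
    (hβ : 0 < β) (V : EuclideanSpace ℝ (Fin d) → ℝ) (Vstar : ℝ)
    (hV_pos : ∀ x, 0 < V x)
    (hV_C2 : ContDiff ℝ 2 V)
    (hV_coercive : Tendsto V (cocompact (EuclideanSpace ℝ (Fin d))) atTop)
    (hV_int : Integrable (fun x => ‖x‖ ^ 2 * Real.exp (-2 * V x / A ^ 2)) volume)
    (hVstar_pos : 0 < Vstar)
    (hVstar_min : ∀ x, Vstar ≤ V x)
    (hargmin : ∃ S : Finset (EuclideanSpace ℝ (Fin d)), S.Nonempty ∧
      (∀ x, V x = Vstar ↔ x ∈ S) ∧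
      ∀ x ∈ S, ∀ v : EuclideanSpace ℝ (Fin d), v ≠ 0 →
        0 < iteratedFDeriv ℝ 2 V x ![v, v]) :
    ∃ C : ℝ, 0 < C ∧ ∀ n : ℕ, 2 ≤ n → ∀ s t : ℝ,
      s ∈ Set.Icc (A / Real.sqrt (Real.log (CT * ((n : ℝ) + 1) ^ (1 + β) + Real.exp 1)))
        (A / Real.sqrt (Real.log (CT * (n : ℝ) ^ (1 + β) + Real.exp 1))) →
      t ∈ Set.Icc (A / Real.sqrt (Real.log (CT * ((n : ℝ) + 1) ^ (1 + β) + Real.exp 1)))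
        (A / Real.sqrt (Real.log (CT * (n : ℝ) ^ (1 + β) + Real.exp 1))) →
      dTV (gibbs V Vstar s) (gibbs V Vstar t) ≤ C / ((n : ℝ) * Real.log (n : ℝ)) := by
  obtain ⟨S, hS, hVS, hpos⟩ := hargmin
  set W : EuclideanSpace ℝ (Fin d) → ℝ := fun x => V x - Vstar with hWdef
  have hWc : Continuous W := hV_C2.continuous.sub continuous_const
  have hW0 : ∀ x, 0 ≤ W x := fun x => sub_nonneg.2 (hVstar_min x)
  have hWcoer : Tendsto W (cocompact _) atTop := by
    simpa [hWdef, sub_eq_add_neg] using tendsto_atTop_add_const_right _ (-Vstar) hV_coercive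
  have hWS : ∀ x, W x = 0 ↔ x ∈ S := fun x => by rw [← hVS, hWdef, sub_eq_zero]
  have hu₀ : 0 < 2 / A ^ 2 := by positivity
  have hfin : partitionFn volume W (2 / A ^ 2) ≠ ∞ := by
    refine lintegral_exp_ne_top (by fun_prop) ?_
    refine (hV_int.const_mul (Real.exp (2 / A ^ 2 * Vstar))).congr (.of_forall fun x => ?_)
    have h : -(2 / A ^ 2 * W x) = 2 / A ^ 2 * Vstar + -2 * V x / A ^ 2 := by
      simp only [hWdef]; ring
    simp only [h, Real.exp_add]
    ring
  have hshrink : ∀ x ∈ S, ∀ θ > 0, ∃ ρ > (0 : ℝ), ∃ r > 0, ∀ y : EuclideanSpace ℝ (Fin d),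
      ‖y‖ < r → W (x + ρ • y) ≤ θ * W (x + y) := fun x hx θ hθ => by
    have hVx : V x = Vstar := (hVS x).2 hx
    have h := exists_homothety_le hV_C2 (x := x) (.of_forall fun y => hVx ▸ hVstar_min y)
      (hpos x hx) hθ
    rwa [hVx] at h
  set L : ℝ → ℝ := fun x => Real.log (CT * x ^ (1 + β) + Real.exp 1) with hL
  have hLmono : ∀ x y : ℝ, 0 < x → x ≤ y → L x ≤ L y := fun x y hx hxy =>
    Real.log_le_log (by positivity) (by gcongr)
  have hL2 : 1 < L 2 := by
    rw [hL, Real.lt_log_iff_exp_lt (by positivity)]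
    linarith [show 0 < CT * (2 : ℝ) ^ (1 + β) by positivity]
  set δ := L 2 - 1
  have hδ : 0 < δ := sub_pos.2 hL2
  set G := 1 + |Real.log CT| with hG
  have hG0 : 0 < G := by positivity
  have hlog2 : 0 < Real.log 2 := Real.log_pos one_lt_two
  set R := 1 + G / (2 * Real.log 2) with hR
  have hR0 : 0 < R := by positivity
  obtain ⟨D, hD, hdoub⟩ := partitionFn_doubling volume hWc hW0 hWcoer hS hWS hshrink hu₀ hfin
    (R := R * (1 + δ)) (by positivity)
  set K := (1 + δ) / δ * D.toReal
  have hK : 0 ≤ K := by positivity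
  refine ⟨2 * (K * G) + 1, by positivity, fun n hn s t hs ht => ?_⟩
  have hn2 : (2 : ℝ) ≤ n := by exact_mod_cast hn
  have hn0 : (0 : ℝ) < n := by linarith
  have hlogn : 0 < Real.log n := Real.log_pos (by linarith)
  have hLn : 1 + δ ≤ L n := by simpa [δ] using hLmono 2 n two_pos hn2
  have hLn0 : 0 < L n := by linarith
  have hLn1 : L n ≤ L (n + 1) := hLmono n (n + 1) hn0 (by linarith)
  have hinc : (L (n + 1) - L n) / L n ≤ G / (n * Real.log n) :=
    log_schedule_increment_le hCT hβ (by linarith)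
  have hincR : L (n + 1) ≤ R * L n := by
    have h1 : G / (n * Real.log n) ≤ G / (2 * Real.log 2) := by gcongr
    have h2 := (div_le_iff₀ hLn0).1 (hinc.trans h1)
    rw [hR]
    linarith
  have hpos_of : ∀ a ∈ Set.Icc (A / √(L (n + 1))) (A / √(L n)),
      2 / A ^ 2 * L n ≤ 2 / a ^ 2 ∧ 2 / a ^ 2 ≤ 2 / A ^ 2 * L (n + 1) := fun a ha => by
    have hl : 0 < A / √(L (n + 1)) := div_pos hA (Real.sqrt_pos.2 (by linarith))
    have ha0 : 0 < a := hl.trans_le ha.1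
    have key : ∀ l : ℝ, 0 < l → 2 / A ^ 2 * l = 2 / (A / √l) ^ 2 := fun l hl => by
      rw [div_pow, Real.sq_sqrt hl.le]; field_simp
    rw [key _ hLn0, key _ (hLn0.trans_le hLn1)]
    refine ⟨?_, ?_⟩
    · gcongr; exact ha.2
    · gcongr; exact ha.1
  have main : ∀ s t : ℝ, s ∈ Set.Icc (A / √(L (n + 1))) (A / √(L n)) →
      t ∈ Set.Icc (A / √(L (n + 1))) (A / √(L n)) → 2 / s ^ 2 ≤ 2 / t ^ 2 →
      dTV (gibbs V Vstar s) (gibbs V Vstar t) ≤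
        (2 * (K * G) + 1) / ((n : ℝ) * Real.log (n : ℝ)) := fun s t hs ht hst => by
    obtain ⟨hs1, -⟩ := hpos_of s hs
    obtain ⟨-, ht2⟩ := hpos_of t ht
    set u := 2 / s ^ 2
    set v := 2 / t ^ 2
    have hu : 0 < u := lt_of_lt_of_le (by positivity) hs1
    have hu1 : (1 + δ) * (2 / A ^ 2) ≤ u := by
      refine le_trans ?_ hs1
      rw [mul_comm]
      gcongr
    have hrel : (v - u) / u ≤ (L (n + 1) - L n) / L n := by
      have hc : (L (n + 1) - L n) / L n =
          (2 / A ^ 2 * L (n + 1) - 2 / A ^ 2 * L n) / (2 / A ^ 2 * L n) := by field_simp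
      rw [hc]
      have : 2 / A ^ 2 * L n ≤ 2 / A ^ 2 * L (n + 1) := by gcongr
      gcongr
    have hvR : v ≤ R * u := by
      calc v ≤ 2 / A ^ 2 * L (n + 1) := ht2
        _ ≤ 2 / A ^ 2 * (R * L n) := by gcongr
        _ = R * (2 / A ^ 2 * L n) := by ring
        _ ≤ R * u := by gcongr
    have hratio := partitionFn_le_mul hWc.measurable hu₀ hδ hD hdoub hu1 hst hvR
    have hfinu : partitionFn volume W u ≠ ∞ :=
      ne_top_of_le_ne_top hfin (partitionFn_antitone hW0 (by nlinarith))
    have hvu : 0 ≤ (v - u) / u := div_nonneg (sub_nonneg.2 hst) hu.le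
    calc dTV (gibbs V Vstar s) (gibbs V Vstar t) ≤ 2 * (K * ((v - u) / u)) :=
          dTV_gibbs_le hV_C2.continuous.measurable hVstar_min (by positivity) hst hfinu hratio
      _ ≤ 2 * (K * (G / (n * Real.log n))) := by
        have := hrel.trans hinc
        gcongr
      _ = 2 * (K * G) / (n * Real.log n) := by ring
      _ ≤ _ := by gcongr; linarith
  rcases le_total (2 / s ^ 2) (2 / t ^ 2) with h | h
  · exact main s t hs ht h
  · rw [dTV_comm]
    exact main t s ht hs h
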